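/- arXiv:2009.09101 — 5 statements merged into one kernel-verified Lean document; each statement's English description precedes it below -/
import Mathlib

section
/- Let (𝒳,d) be a complete metric space carrying a geodesic CAT(0) structure, and suppose 𝒳 has infinite diameter, i.e. sup_{x,y∈𝒳} d(x,y) = ∞. Fix σ² > 0, and suppose δ : 𝒳 → 𝒳 is Borel measurable and unbiased for the family 𝒫 = {P : V₂P = σ²} in the following sense: for every Borel probability measure P on 𝒳 with finite second moments and Fréchet variance V₂P = σ², the set of Fréchet means of the pushforward measure δ_*P equals the set of Fréchet means of P. Then δ(x) = x for every x ∈ 𝒳. -/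
open MeasureTheory ProbabilityTheory Filter

/-- A geodesic CAT(0) structure on a metric space `X`: a geodesic selection
`γ x y t` (`t ∈ [0,1]`) with endpoints `x`, `y`, affinely parameterized,
satisfying the CAT(0) comparison inequality. -/
structure GeodesicCAT0 (X : Type*) [MetricSpace X] where
  γ : X → X → ℝ → X
  γ_zero : ∀ x y : X, γ x y 0 = x
  γ_one : ∀ x y : X, γ x y 1 = y
  dist_γ : ∀ x y : X, ∀ s ∈ Set.Icc (0:ℝ) 1, ∀ t ∈ Set.Icc (0:ℝ) 1,
    dist (γ x y s) (γ x y t) = |s - t| * dist x y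
  cat0 : ∀ x y z : X, ∀ t ∈ Set.Icc (0:ℝ) 1,
    dist (γ x y t) z ^ 2 ≤
      (1 - t) * dist x z ^ 2 + t * dist y z ^ 2 - t * (1 - t) * dist x y ^ 2

/-- Joint Borel measurability of the geodesic map of a `GeodesicCAT0` structure. -/
def GeodesicCAT0.MeasurableGeo {X : Type*} [MetricSpace X] [MeasurableSpace X]
    (G : GeodesicCAT0 X) : Prop :=
  Measurable fun p : X × X × ℝ => G.γ p.1 p.2.1 p.2.2

/-- `θ` is a Fréchet mean of the Borel random object `f` (defined on a probability
space `(Ω, P)`, taking values in a metric space): it minimizes `z ↦ E[d(z, f)²]`. -/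
def IsFrechetMeanRV {Ω X : Type*} [MetricSpace X] [MeasurableSpace Ω]
    (P : Measure Ω) (f : Ω → X) (θ : X) : Prop :=
  ∀ z : X, ∫ ω, dist θ (f ω) ^ 2 ∂P ≤ ∫ ω, dist z (f ω) ^ 2 ∂P

/-- `θ` is a Fréchet mean of the Borel probability measure `P` on a metric space:
it minimizes `z ↦ ∫ d(z,u)² dP(u)`. -/
def IsFrechetMean {X : Type*} [MetricSpace X] [MeasurableSpace X]
    (P : Measure X) (θ : X) : Prop :=
  ∀ z : X, ∫ u, dist θ u ^ 2 ∂P ≤ ∫ u, dist z u ^ 2 ∂P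

/-- The James–Stein shrinkage weight `w = min(1, σ²/dsq)` as a function of the squared
distance `dsq` to the shrinkage point, with `w = 1` when `dsq = 0`. -/
noncomputable def jsWeight (σsq dsq : ℝ) : ℝ :=
  if dsq = 0 then 1 else min 1 (σsq / dsq)

namespace GeodesicCAT0

variable {X : Type*} [MetricSpace X]

/-- The weighted sum of squared distances to two points exceeds its value at the corresponding
point of the geodesic by at least the squared distance to that point. -/
theorem weighted_sq_dist_ge (G : GeodesicCAT0 X) (a b z : X) {t : ℝ}
    (ht : t ∈ Set.Icc (0 : ℝ) 1) :
    dist (G.γ a b t) z ^ 2 + t * (1 - t) * dist a b ^ 2 ≤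
      (1 - t) * dist z a ^ 2 + t * dist z b ^ 2 := by
  have h := G.cat0 a b z t ht
  rw [dist_comm z a, dist_comm z b]
  linarith

theorem dist_left_γ (G : GeodesicCAT0 X) (a b : X) {t : ℝ} (ht : t ∈ Set.Icc (0 : ℝ) 1) :
    dist (G.γ a b t) a = t * dist a b := by
  have h := G.dist_γ a b t ht 0 (by simp)
  rwa [G.γ_zero, sub_zero, abs_of_nonneg ht.1] at h

theorem dist_right_γ (G : GeodesicCAT0 X) (a b : X) {t : ℝ} (ht : t ∈ Set.Icc (0 : ℝ) 1) :
    dist (G.γ a b t) b = (1 - t) * dist a b := by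
  have h := G.dist_γ a b t ht 1 (by simp)
  rwa [G.γ_one, abs_sub_comm, abs_of_nonneg (sub_nonneg.2 ht.2)] at h

theorem weighted_sq_dist_γ (G : GeodesicCAT0 X) (a b : X) {t : ℝ}
    (ht : t ∈ Set.Icc (0 : ℝ) 1) :
    (1 - t) * dist (G.γ a b t) a ^ 2 + t * dist (G.γ a b t) b ^ 2 =
      t * (1 - t) * dist a b ^ 2 := by
  rw [G.dist_left_γ a b ht, G.dist_right_γ a b ht]
  ring

end GeodesicCAT0

/-- The probability measure with mass `1 - t` at `a` and mass `t` at `b`. -/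
noncomputable def twoPoint {X : Type*} [MeasurableSpace X] (a b : X) (t : ℝ) : Measure X :=
  ENNReal.ofReal (1 - t) • Measure.dirac a + ENNReal.ofReal t • Measure.dirac b

section TwoPoint

variable {X : Type*} [MeasurableSpace X]

theorem isProbabilityMeasure_twoPoint (a b : X) {t : ℝ} (ht : t ∈ Set.Icc (0 : ℝ) 1) :
    IsProbabilityMeasure (twoPoint a b t) := by
  constructor
  simp [twoPoint, ← ENNReal.ofReal_add (sub_nonneg.2 ht.2) ht.1]

theorem map_twoPoint {f : X → X} (hf : Measurable f) (a b : X) (t : ℝ) :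
    (twoPoint a b t).map f = twoPoint (f a) (f b) t := by
  simp [twoPoint, Measure.map_add _ _ hf, Measure.map_smul, Measure.map_dirac' hf]

theorem integrable_twoPoint [MeasurableSingletonClass X] (g : X → ℝ) (a b : X) (t : ℝ) :
    Integrable g (twoPoint a b t) :=
  ((integrable_dirac (by simp)).smul_measure ENNReal.ofReal_ne_top).add_measure
    ((integrable_dirac (by simp)).smul_measure ENNReal.ofReal_ne_top)

theorem integral_twoPoint [MeasurableSingletonClass X] (g : X → ℝ) (a b : X) {t : ℝ}
    (ht : t ∈ Set.Icc (0 : ℝ) 1) :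
    ∫ u, g u ∂(twoPoint a b t) = (1 - t) * g a + t * g b := by
  rw [twoPoint, integral_add_measure
    ((integrable_dirac (by simp)).smul_measure ENNReal.ofReal_ne_top)
    ((integrable_dirac (by simp)).smul_measure ENNReal.ofReal_ne_top)]
  simp [integral_smul_measure, ENNReal.toReal_ofReal, ht.1, ht.2]

end TwoPoint

namespace GeodesicCAT0

variable {X : Type*} [MetricSpace X] [MeasurableSpace X] [MeasurableSingletonClass X]

theorem isFrechetMean_twoPoint_iff (G : GeodesicCAT0 X) (a b θ : X) {t : ℝ}
    (ht : t ∈ Set.Icc (0 : ℝ) 1) :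
    IsFrechetMean (twoPoint a b t) θ ↔ θ = G.γ a b t := by
  simp only [IsFrechetMean, integral_twoPoint _ a b ht]
  constructor
  · intro h
    have h₁ := h (G.γ a b t)
    have h₂ := G.weighted_sq_dist_ge a b θ ht
    rw [G.weighted_sq_dist_γ a b ht] at h₁
    have h₃ : dist (G.γ a b t) θ ^ 2 = 0 := le_antisymm (by linarith) (sq_nonneg _)
    exact (dist_eq_zero.1 (pow_eq_zero_iff two_ne_zero |>.1 h₃)).symm
  · rintro rfl z
    rw [G.weighted_sq_dist_γ a b ht]
    nlinarith [G.weighted_sq_dist_ge a b z ht, sq_nonneg (dist (G.γ a b t) z)]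

theorem iInf_integral_twoPoint (G : GeodesicCAT0 X) (a b : X) {t : ℝ}
    (ht : t ∈ Set.Icc (0 : ℝ) 1) :
    (⨅ z : X, ∫ u, dist z u ^ 2 ∂(twoPoint a b t)) = t * (1 - t) * dist a b ^ 2 := by
  simp only [integral_twoPoint _ a b ht]
  refine IsLeast.csInf_eq ⟨⟨G.γ a b t, G.weighted_sq_dist_γ a b ht⟩, ?_⟩
  rintro _ ⟨z, rfl⟩
  nlinarith [G.weighted_sq_dist_ge a b z ht, sq_nonneg (dist (G.γ a b t) z)]

end GeodesicCAT0

theorem exists_mul_one_sub_eq {c : ℝ} (hc₀ : 0 ≤ c) (hc : c < 1 / 4) :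
    ∃ t : ℝ, 0 ≤ t ∧ t < 1 / 2 ∧ t * (1 - t) = c := by
  have hs : 0 < √(1 - 4 * c) := Real.sqrt_pos.2 (by linarith)
  have hs₁ : √(1 - 4 * c) ≤ 1 := Real.sqrt_le_one.2 (by linarith)
  have hs₂ : √(1 - 4 * c) ^ 2 = 1 - 4 * c := Real.sq_sqrt (by linarith)
  exact ⟨(1 - √(1 - 4 * c)) / 2, by linarith, by linarith, by linarith⟩

theorem exists_lt_dist_of_ediam_univ_eq_top {X : Type*} [MetricSpace X]
    (h : Metric.ediam (Set.univ : Set X) = ⊤) (x : X) (R : ℝ) : ∃ y, R < dist x y := by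
  by_contra! hR
  refine Metric.isBounded_iff_ediam_ne_top.1
    ((Metric.isBounded_closedBall (x := x) (r := R)).subset fun y _ => ?_) h
  rw [Metric.mem_closedBall, dist_comm]
  exact hR y

/-- in a complete CAT(0) space of infinite diameter, the only estimator
that is unbiased (in the sense of equality of Fréchet-mean sets of `δ_*P` and `P`) for
the family of all Borel probability measures with finite second moments and Fréchet
variance `σ²` is the identity. -/
theorem unbiased_estimator_is_identity {X : Type*} [MetricSpace X] [CompleteSpace X]
    [MeasurableSpace X] [BorelSpace X]
    (G : GeodesicCAT0 X)
    (hdiam : EMetric.diam (Set.univ : Set X) = ⊤)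
    (σsq : ℝ) (hσ : 0 < σsq)
    (δ : X → X) (hδ : Measurable δ)
    (hunbiased : ∀ P : Measure X, IsProbabilityMeasure P →
      (∀ z : X, Integrable (fun u => dist z u ^ 2) P) →
      (⨅ z : X, ∫ u, dist z u ^ 2 ∂P) = σsq →
      {θ : X | IsFrechetMean (P.map δ) θ} = {θ : X | IsFrechetMean P θ}) :
    ∀ x : X, δ x = x := by
  have key : ∀ a b : X, ∀ t ∈ Set.Icc (0 : ℝ) 1, t * (1 - t) * dist a b ^ 2 = σsq →
      G.γ a b t = G.γ (δ a) (δ b) t := by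
    intro a b t ht hvar
    have h := hunbiased (twoPoint a b t) (isProbabilityMeasure_twoPoint a b ht)
      (fun z => integrable_twoPoint _ a b t) ((G.iInf_integral_twoPoint a b ht).trans hvar)
    rw [map_twoPoint hδ] at h
    exact (G.isFrechetMean_twoPoint_iff (δ a) (δ b) _ ht).1
      (h.ge ((G.isFrechetMean_twoPoint_iff a b _ ht).2 rfl))
  intro x
  have bound : ∀ b : X, 0 < dist x b → 4 * σsq < dist x b ^ 2 →
      dist (δ x) x * dist x b ≤ 4 * σsq := by
    intro b hb hD
    have hD₀ : 0 < dist x b ^ 2 := by positivity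
    obtain ⟨t, ht₀, ht₁, htc⟩ := exists_mul_one_sub_eq (c := σsq / dist x b ^ 2)
      (by positivity) (by rw [div_lt_iff₀ hD₀]; linarith)
    have hvar : t * (1 - t) * dist x b ^ 2 = σsq := by
      rw [htc, div_mul_cancel₀ _ hD₀.ne']
    have ht : t ∈ Set.Icc (0 : ℝ) 1 := ⟨ht₀, by linarith⟩
    have ht' : 1 - t ∈ Set.Icc (0 : ℝ) 1 := ⟨by linarith, by linarith⟩
    have h₁ := key x b t ht hvar
    have h₂ := key x b (1 - t) ht' (by rw [← hvar]; ring)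
    have hdist : dist (δ x) (δ b) = dist x b := by
      have h₃ := G.dist_γ x b t ht (1 - t) ht'
      rw [h₁, h₂, G.dist_γ _ _ t ht (1 - t) ht'] at h₃
      exact mul_left_cancel₀ (abs_ne_zero.2 (by linarith)) h₃
    have h₄ := G.dist_left_γ x b ht
    have h₅ := G.dist_left_γ (δ x) (δ b) ht
    rw [← h₁, hdist] at h₅
    have h₆ := dist_triangle_left (δ x) x (G.γ x b t)
    have h₇ : dist (δ x) x * dist x b ≤ 2 * t * dist x b * dist x b :=
      mul_le_mul_of_nonneg_right (by linarith) hb.le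
    have h₈ : 0 ≤ t * (1 - 2 * t) * dist x b ^ 2 :=
      mul_nonneg (mul_nonneg ht₀ (by linarith)) hD₀.le
    nlinarith
  by_contra hne
  have hpos : 0 < dist (δ x) x := dist_pos.2 hne
  obtain ⟨b, hb⟩ := exists_lt_dist_of_ediam_univ_eq_top hdiam x
    (max (1 + 4 * σsq) (4 * σsq / dist (δ x) x))
  have hb₁ := (le_max_left _ _).trans_lt hb
  have hb₂ := (le_max_right _ _).trans_lt hb
  rw [div_lt_iff₀ hpos] at hb₂
  have := bound b (by linarith) (by nlinarith)
  linarith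
end

section
/- Let (𝒳,d) be a complete metric space carrying a geodesic CAT(0) structure, and suppose 𝒳 contains a geodesic line, i.e. there is an isometric embedding ℓ : ℝ → 𝒳 with d(ℓ(s),ℓ(t)) = |s−t| for all s,t ∈ ℝ. Fix σ² > 0 and let 𝒫 be the family of Borel probability measures P on 𝒳 with finite second moments that admit a Fréchet mean and have Fréchet variance V₂P = σ². Then the identity map is a minimax estimator of the Fréchet mean for 𝒫: for every Borel measurable estimator δ : 𝒳 → 𝒳, sup over P ∈ 𝒫 and Fréchet means θ of P of E_{X∼P}[d(θ,δ(X))²] is at least σ², while for every P ∈ 𝒫 and every Fréchet mean θ of P one has E_{X∼P}[d(θ,X)²] = σ². -/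
open MeasureTheory ProbabilityTheory Filter

/-- The uniform probability measure on the two (possibly equal) points `a` and `b`. -/
noncomputable def twoPointMeasure {X : Type*} [MeasurableSpace X] (a b : X) : Measure X :=
  (2⁻¹ : ENNReal) • Measure.dirac a + (2⁻¹ : ENNReal) • Measure.dirac b

instance twoPointMeasure.isProbabilityMeasure {X : Type*} [MeasurableSpace X] (a b : X) :
    IsProbabilityMeasure (twoPointMeasure a b) :=
  ⟨by simp [twoPointMeasure, ENNReal.inv_two_add_inv_two]⟩

theorem integrable_twoPointMeasure {X : Type*} [MeasurableSpace X] [MeasurableSingletonClass X]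
    (a b : X) (f : X → ℝ) : Integrable f (twoPointMeasure a b) :=
  ((integrable_dirac (by simp)).smul_measure (by simp)).add_measure
    ((integrable_dirac (by simp)).smul_measure (by simp))

theorem integral_twoPointMeasure {X : Type*} [MeasurableSpace X] [MeasurableSingletonClass X]
    (a b : X) (f : X → ℝ) : ∫ u, f u ∂(twoPointMeasure a b) = (f a + f b) / 2 := by
  rw [twoPointMeasure, integral_add_measure
    ((integrable_dirac (by simp)).smul_measure (by simp))
    ((integrable_dirac (by simp)).smul_measure (by simp))]
  simp only [integral_smul_measure, integral_dirac, ENNReal.toReal_inv, ENNReal.toReal_ofNat,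
    smul_eq_mul]
  ring

theorem sq_dist_div_two_le {X : Type*} [PseudoMetricSpace X] (a b z : X) :
    dist a b ^ 2 / 2 ≤ dist a z ^ 2 + dist b z ^ 2 := by
  have h := pow_le_pow_left₀ dist_nonneg (dist_triangle_right a b z) 2
  nlinarith [sq_nonneg (dist a z - dist b z)]

theorem sq_dist_div_four_le_integral_twoPointMeasure {X : Type*} [MetricSpace X]
    [MeasurableSpace X] [MeasurableSingletonClass X] (a b z : X) :
    dist a b ^ 2 / 4 ≤ ∫ u, dist z u ^ 2 ∂(twoPointMeasure a b) := by
  rw [integral_twoPointMeasure, dist_comm z a, dist_comm z b]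
  linarith [sq_dist_div_two_le a b z]

/-- A metric midpoint of `a` and `b` attains the lower bound `d(a,b)² / 4` of the
Fréchet functional. -/
theorem integral_twoPointMeasure_midpoint {X : Type*} [MetricSpace X]
    [MeasurableSpace X] [MeasurableSingletonClass X] {a b m : X}
    (ha : dist m a = dist a b / 2) (hb : dist m b = dist a b / 2) :
    ∫ u, dist m u ^ 2 ∂(twoPointMeasure a b) = dist a b ^ 2 / 4 := by
  rw [integral_twoPointMeasure, ha, hb]
  ring

theorem isFrechetMean_twoPointMeasure {X : Type*} [MetricSpace X]
    [MeasurableSpace X] [MeasurableSingletonClass X] {a b m : X}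
    (ha : dist m a = dist a b / 2) (hb : dist m b = dist a b / 2) :
    IsFrechetMean (twoPointMeasure a b) m := fun z =>
  (integral_twoPointMeasure_midpoint ha hb).trans_le
    (sq_dist_div_four_le_integral_twoPointMeasure a b z)

theorem IsFrechetMean.iInf_eq {X : Type*} [MetricSpace X] [MeasurableSpace X] {P : Measure X}
    {θ : X} (h : IsFrechetMean P θ) :
    ⨅ z : X, ∫ u, dist z u ^ 2 ∂P = ∫ u, dist θ u ^ 2 ∂P := by
  have : Nonempty X := ⟨θ⟩
  exact le_antisymm (ciInf_le ⟨_, Set.forall_mem_range.2 h⟩ θ) (le_ciInf h)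

/-- On an isometric line no map `δ` has mean squared error bounded by some `M < s²` at all the
uniform measures on `{2ks - s, 2ks + s}` simultaneously. -/
theorem sq_le_of_forall_twoPoint_risk_le {X : Type*} [MetricSpace X] (ℓ : ℝ → X)
    (hline : ∀ s t : ℝ, dist (ℓ s) (ℓ t) = |s - t|) (δ : X → X) (s M : ℝ)
    (hM : ∀ t : ℝ,
      (dist (ℓ t) (δ (ℓ (t - s))) ^ 2 + dist (ℓ t) (δ (ℓ (t + s))) ^ 2) / 2 ≤ M) :
    s ^ 2 ≤ M := by
  by_contra! hlt
  have key : ∀ k : ℕ, 2 * k * (s ^ 2 - M) ≤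
      dist (ℓ (2 * k * s)) (δ (ℓ (2 * k * s - s))) ^ 2 := by
    intro k
    induction k with
    | zero => simp
    | succ k ih =>
      have h1 := hM (2 * k * s)
      have h2 := sq_dist_div_two_le (ℓ (2 * k * s)) (ℓ (2 * (k + 1 : ℕ) * s))
        (δ (ℓ (2 * k * s + s)))
      have h3 : 2 * ((k + 1 : ℕ) : ℝ) * s - s = 2 * k * s + s := by push_cast; ring
      have h4 : (2 * k * s - 2 * ((k + 1 : ℕ) : ℝ) * s) ^ 2 = 4 * s ^ 2 := by push_cast; ring
      rw [hline, sq_abs, h4] at h2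
      rw [h3]
      push_cast at h2 ⊢
      linarith
  obtain ⟨n, hn⟩ := exists_nat_gt (M / (s ^ 2 - M))
  rw [div_lt_iff₀ (sub_pos.2 hlt)] at hn
  have h1 := hM (2 * n * s)
  have h2 := key n
  have h3 := sq_nonneg (dist (ℓ (2 * n * s)) (δ (ℓ (2 * n * s + s))))
  linarith

/-- in a complete CAT(0) space containing a geodesic line, the identity map
is a minimax estimator of the Fréchet mean for the family of Borel probability measures
with finite second moments that admit a Fréchet mean and have Fréchet variance `σ²`:
every measurable estimator has worst-case risk at least `σ²`, while the identity has
risk exactly `σ²` at every member of the family. -/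
theorem identity_is_minimax {X : Type*} [MetricSpace X] [CompleteSpace X]
    [MeasurableSpace X] [BorelSpace X]
    (G : GeodesicCAT0 X)
    (ℓ : ℝ → X) (hline : ∀ s t : ℝ, dist (ℓ s) (ℓ t) = |s - t|)
    (σsq : ℝ) (hσ : 0 < σsq) :
    (∀ δ : X → X, Measurable δ →
      ENNReal.ofReal σsq ≤
        ⨆ (P : Measure X) (_ : IsProbabilityMeasure P)
          (_ : ∀ z : X, Integrable (fun u => dist z u ^ 2) P)
          (_ : (⨅ z : X, ∫ u, dist z u ^ 2 ∂P) = σsq)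
          (θ : X) (_ : IsFrechetMean P θ),
          ∫⁻ u, ENNReal.ofReal (dist θ (δ u) ^ 2) ∂P) ∧
    (∀ P : Measure X, IsProbabilityMeasure P →
      (∀ z : X, Integrable (fun u => dist z u ^ 2) P) →
      (⨅ z : X, ∫ u, dist z u ^ 2 ∂P) = σsq →
      ∀ θ : X, IsFrechetMean P θ →
      ∫ u, dist θ u ^ 2 ∂P = σsq) := by
  refine ⟨fun δ _ => ?_, fun P _ _ hV θ hθ => hθ.iInf_eq.symm.trans hV⟩
  by_contra! hlt
  set S := ⨆ (P : Measure X) (_ : IsProbabilityMeasure P)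
    (_ : ∀ z : X, Integrable (fun u => dist z u ^ 2) P)
    (_ : (⨅ z : X, ∫ u, dist z u ^ 2 ∂P) = σsq)
    (θ : X) (_ : IsFrechetMean P θ),
    ∫⁻ u, ENNReal.ofReal (dist θ (δ u) ^ 2) ∂P with hS
  have hSσ : S.toReal < σsq := ENNReal.toReal_lt_of_lt_ofReal hlt
  refine hSσ.not_ge ?_
  rw [← Real.sq_sqrt hσ.le]
  refine sq_le_of_forall_twoPoint_risk_le ℓ hline δ _ _ fun t => ?_
  set s := √σsq with hs
  have hs0 : 0 ≤ s := Real.sqrt_nonneg _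
  have hab : dist (ℓ (t - s)) (ℓ (t + s)) = 2 * s := by
    rw [hline, show t - s - (t + s) = -(2 * s) by ring, abs_neg, abs_of_nonneg (by linarith)]
  have ha : dist (ℓ t) (ℓ (t - s)) = dist (ℓ (t - s)) (ℓ (t + s)) / 2 := by
    rw [hab, hline, sub_sub_cancel, abs_of_nonneg hs0]
    ring
  have hb : dist (ℓ t) (ℓ (t + s)) = dist (ℓ (t - s)) (ℓ (t + s)) / 2 := by
    rw [hab, hline, sub_add_cancel_left, abs_neg, abs_of_nonneg hs0]
    ring
  have hmean := isFrechetMean_twoPointMeasure ha hb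
  have hvar : (⨅ z : X, ∫ u, dist z u ^ 2 ∂(twoPointMeasure (ℓ (t - s)) (ℓ (t + s)))) = σsq := by
    rw [hmean.iInf_eq, integral_twoPointMeasure_midpoint ha hb, hab, mul_pow, Real.sq_sqrt hσ.le]
    ring
  have hle : ∫⁻ u, ENNReal.ofReal (dist (ℓ t) (δ u) ^ 2)
      ∂(twoPointMeasure (ℓ (t - s)) (ℓ (t + s))) ≤ S :=
    le_iSup_of_le _ <| le_iSup_of_le inferInstance <|
      le_iSup_of_le (fun _ => integrable_twoPointMeasure _ _ _) <| le_iSup_of_le hvar <|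
        le_iSup_of_le (ℓ t) <| le_iSup_of_le hmean le_rfl
  rw [← ofReal_integral_eq_lintegral_ofReal (integrable_twoPointMeasure _ _ _)
    (ae_of_all _ fun _ => sq_nonneg _), integral_twoPointMeasure] at hle
  exact (ENNReal.ofReal_le_iff_le_toReal hlt.ne_top).1 hle
end

section
/- Let (𝒳,d) be a metric space carrying a geodesic CAT(0) structure whose geodesic map is jointly Borel measurable, let X be a Borel random object in 𝒳 with E[d(z,X)²] < ∞ for all z ∈ 𝒳, let θ be a Fréchet mean of X, set σ² := E[d(θ,X)²], and let ψ ∈ 𝒳. Then for every t ∈ [0,1], E[d(θ,[X,ψ]_t)²] ≤ (1−t)·σ² + t·d(θ,ψ)² − t·(1−t)·E[d(X,ψ)²]. Consequently, if σ² > 0 then there exists t ∈ (0,1] such that E[d(θ,[X,ψ]_t)²] < σ², i.e. the geodesic shrinkage estimator [X,ψ]_t has strictly smaller squared-distance risk than X. -/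
open MeasureTheory ProbabilityTheory Filter

/-- Integrated CAT(0) inequality along the geodesic from a fixed point `x` to a fixed point `y`. -/
theorem GeodesicCAT0.integral_dist_sq_le {X Ω : Type*} [MetricSpace X] [MeasurableSpace Ω]
    (G : GeodesicCAT0 X) (P : Measure Ω) [IsProbabilityMeasure P] (f : Ω → X)
    (hint : ∀ z : X, Integrable (fun ω => dist z (f ω) ^ 2) P)
    (x y : X) {t : ℝ} (ht : t ∈ Set.Icc (0:ℝ) 1) :
    ∫ ω, dist (G.γ x y t) (f ω) ^ 2 ∂P ≤
      (1 - t) * ∫ ω, dist x (f ω) ^ 2 ∂P + t * ∫ ω, dist y (f ω) ^ 2 ∂P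
        - t * (1 - t) * dist x y ^ 2 := by
  have hx := (hint x).const_mul (1 - t)
  have hy := (hint y).const_mul t
  have hxy : Integrable (fun ω => (1 - t) * dist x (f ω) ^ 2 + t * dist y (f ω) ^ 2) P :=
    hx.add hy
  have hc := integrable_const (μ := P) (t * (1 - t) * dist x y ^ 2)
  calc
    _ ≤ ∫ ω, ((1 - t) * dist x (f ω) ^ 2 + t * dist y (f ω) ^ 2
          - t * (1 - t) * dist x y ^ 2) ∂P :=
      integral_mono (hint _) (hxy.sub hc) fun ω => G.cat0 x y (f ω) t ht
    _ = _ := by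
      rw [integral_sub hxy hc, integral_add hx hy, integral_const_mul, integral_const_mul]
      simp

/-- Integrated CAT(0) inequality along the geodesics from a random point to a fixed point `y`. -/
theorem GeodesicCAT0.integral_dist_sq_random_le {X Ω : Type*} [MetricSpace X]
    [MeasurableSpace Ω] (G : GeodesicCAT0 X) (P : Measure Ω) [IsProbabilityMeasure P]
    (f : Ω → X) (hint : ∀ z : X, Integrable (fun ω => dist z (f ω) ^ 2) P)
    (z y : X) {t : ℝ} (ht : t ∈ Set.Icc (0:ℝ) 1) :
    ∫ ω, dist z (G.γ (f ω) y t) ^ 2 ∂P ≤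
      (1 - t) * ∫ ω, dist z (f ω) ^ 2 ∂P + t * dist z y ^ 2
        - t * (1 - t) * ∫ ω, dist (f ω) y ^ 2 ∂P := by
  have hz := (hint z).const_mul (1 - t)
  have hc := integrable_const (μ := P) (t * dist z y ^ 2)
  have hy : Integrable (fun ω => t * (1 - t) * dist (f ω) y ^ 2) P := by
    simpa only [dist_comm] using (hint y).const_mul (t * (1 - t))
  have hzc : Integrable (fun ω => (1 - t) * dist z (f ω) ^ 2 + t * dist z y ^ 2) P :=
    hz.add hc
  calc
    _ ≤ ∫ ω, ((1 - t) * dist z (f ω) ^ 2 + t * dist z y ^ 2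
          - t * (1 - t) * dist (f ω) y ^ 2) ∂P := by
      refine integral_mono_of_nonneg (ae_of_all _ fun ω => sq_nonneg _) (hzc.sub hy)
        (ae_of_all _ fun ω => ?_)
      have h := G.cat0 (f ω) y z t ht
      rwa [dist_comm _ z, dist_comm _ z, dist_comm y z] at h
    _ = _ := by
      rw [integral_sub hzc hy, integral_add hz hc, integral_const_mul,
        integral_const_mul (t * (1 - t))]
      simp

/-- the CAT(0) risk bound for the geodesic shrinkage estimator
`[X,ψ]_t`, and the consequent existence of a strictly risk-improving `t` when the
Fréchet variance is positive. -/
theorem shrinkage_risk_bound {X : Type*} [MetricSpace X] [MeasurableSpace X] [BorelSpace X]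
    (G : GeodesicCAT0 X) (hG : G.MeasurableGeo)
    {Ω : Type*} [MeasurableSpace Ω] (P : Measure Ω) [IsProbabilityMeasure P]
    (Xr : Ω → X) (hXr : Measurable Xr)
    (hint : ∀ z : X, Integrable (fun ω => dist z (Xr ω) ^ 2) P)
    (θ : X) (hθ : IsFrechetMeanRV P Xr θ)
    (σsq : ℝ) (hσ : σsq = ∫ ω, dist θ (Xr ω) ^ 2 ∂P)
    (ψ : X) :
    (∀ t ∈ Set.Icc (0:ℝ) 1,
      ∫ ω, dist θ (G.γ (Xr ω) ψ t) ^ 2 ∂P ≤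
        (1 - t) * σsq + t * dist θ ψ ^ 2
          - t * (1 - t) * ∫ ω, dist (Xr ω) ψ ^ 2 ∂P) ∧
    (0 < σsq → ∃ t ∈ Set.Ioc (0:ℝ) 1,
      ∫ ω, dist θ (G.γ (Xr ω) ψ t) ^ 2 ∂P < σsq) := by
  have hbound : ∀ t ∈ Set.Icc (0:ℝ) 1, ∫ ω, dist θ (G.γ (Xr ω) ψ t) ^ 2 ∂P ≤
      (1 - t) * σsq + t * dist θ ψ ^ 2 - t * (1 - t) * ∫ ω, dist (Xr ω) ψ ^ 2 ∂P := by
    intro t ht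
    rw [hσ]
    exact G.integral_dist_sq_random_le P Xr hint θ ψ ht
  refine ⟨hbound, fun hpos => ?_⟩
  have hmean : ∀ z, σsq ≤ ∫ ω, dist z (Xr ω) ^ 2 ∂P := fun z => hσ ▸ hθ z
  have hcomm : ∫ ω, dist (Xr ω) ψ ^ 2 ∂P = ∫ ω, dist ψ (Xr ω) ^ 2 ∂P := by
    simp only [dist_comm]
  rw [hcomm] at hbound
  have hV := hmean ψ
  have hcat := fun s hs =>
    (hmean _).trans (G.integral_dist_sq_le P Xr hint θ ψ (t := s) hs)
  rw [← hσ] at hcat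
  set V := ∫ ω, dist ψ (Xr ω) ^ 2 ∂P
  have hd := sq_nonneg (dist θ ψ)
  set D := dist θ ψ ^ 2
  have hVpos : 0 < V := hpos.trans_le hV
  -- A quantitative form of the variance inequality `σsq + D ≤ V`, sufficient here.
  have hvar : D < V := by
    have hs : 0 < σsq / (σsq + D) := by positivity
    have hs1 : σsq / (σsq + D) ≤ 1 := (div_le_one (by positivity)).2 (by linarith)
    have hsD : σsq / (σsq + D) * D < σsq := by
      rw [div_mul_eq_mul_div, div_lt_iff₀ (by positivity)]
      nlinarith
    have h := hcat _ ⟨hs.le, hs1⟩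
    set s := σsq / (σsq + D)
    have h' : s * (σsq + (1 - s) * D) ≤ s * V := by linarith
    linarith [le_of_mul_le_mul_left h' hs]
  have ht : 0 < σsq / V := by positivity
  have ht1 : σsq / V ≤ 1 := (div_le_one hVpos).2 hV
  refine ⟨σsq / V, ⟨ht, ht1⟩, (hbound _ ⟨ht.le, ht1⟩).trans_lt ?_⟩
  have htV : σsq / V * V = σsq := div_mul_cancel₀ _ hVpos.ne'
  set t := σsq / V
  have hgain : 0 < t * (V - D) := mul_pos ht (sub_pos.2 hvar)
  have hsplit : t * (1 - t) * V = t * V - t * σsq := by rw [← htV]; ring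
  linarith
end

section
/- Let (𝒳,d) be a metric space carrying a geodesic CAT(0) structure whose geodesic map is jointly Borel measurable, let X be a Borel random object in 𝒳 with E[d(z,X)²] < ∞ for all z ∈ 𝒳, and let θ be a Fréchet mean of X. Then the bias–variance inequality holds: for every z ∈ 𝒳, E[d(X,z)²] ≥ d(z,θ)² + E[d(X,θ)²]. -/
open MeasureTheory ProbabilityTheory Filter

/-- the bias–variance inequality in a CAT(0) space:
`E[d(X,z)²] ≥ d(z,θ)² + E[d(X,θ)²]` for any Fréchet mean `θ` of `X`. -/
theorem bias_variance_inequality {X : Type*} [MetricSpace X] [MeasurableSpace X]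
    [BorelSpace X]
    (G : GeodesicCAT0 X) (hG : G.MeasurableGeo)
    {Ω : Type*} [MeasurableSpace Ω] (P : Measure Ω) [IsProbabilityMeasure P]
    (Xr : Ω → X) (hXr : Measurable Xr)
    (hint : ∀ z : X, Integrable (fun ω => dist z (Xr ω) ^ 2) P)
    (θ : X) (hθ : IsFrechetMeanRV P Xr θ) :
    ∀ z : X, dist z θ ^ 2 + ∫ ω, dist (Xr ω) θ ^ 2 ∂P ≤ ∫ ω, dist (Xr ω) z ^ 2 ∂P := by
  intro z
  simp_rw [dist_comm (Xr _)]
  set A := ∫ ω, dist θ (Xr ω) ^ 2 ∂P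
  set B := ∫ ω, dist z (Xr ω) ^ 2 ∂P
  rw [dist_comm z θ]
  have key : ∀ t ∈ Set.Icc (0:ℝ) 1,
      A ≤ (1 - t) * A + t * B - t * (1 - t) * dist θ z ^ 2 := by
    intro t ht
    have hsum : Integrable
        (fun ω => (1 - t) * dist θ (Xr ω) ^ 2 + t * dist z (Xr ω) ^ 2) P :=
      ((hint θ).const_mul (1 - t)).add ((hint z).const_mul t)
    calc A ≤ ∫ ω, dist (G.γ θ z t) (Xr ω) ^ 2 ∂P := hθ _
      _ ≤ ∫ ω, ((1 - t) * dist θ (Xr ω) ^ 2 + t * dist z (Xr ω) ^ 2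
            - t * (1 - t) * dist θ z ^ 2) ∂P :=
          integral_mono (hint _) (hsum.sub (integrable_const _))
            fun ω => G.cat0 θ z (Xr ω) t ht
      _ = (1 - t) * A + t * B - t * (1 - t) * dist θ z ^ 2 := by
          rw [integral_sub hsum (integrable_const _),
            integral_add ((hint θ).const_mul _) ((hint z).const_mul _),
            integral_const_mul, integral_const_mul]
          simp [A, B]
  have hD : 0 ≤ dist θ z ^ 2 := sq_nonneg _
  generalize dist θ z ^ 2 = D at *
  by_contra! hlt
  have hε : 0 < D + A - B := by linarith
  have hden : 0 < D + A - B + D + 1 := by linarith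
  set t := (D + A - B) / (D + A - B + D + 1) with ht
  have ht0 : 0 < t := div_pos hε hden
  have hmul : t * (D + A - B + D + 1) = D + A - B := div_mul_cancel₀ _ hden.ne'
  have ht1 : t ≤ 1 := (div_le_one hden).2 (by linarith)
  have hcmp := key t ⟨ht0.le, ht1⟩
  have hdiv : 0 ≤ B - A - (1 - t) * D :=
    nonneg_of_mul_nonneg_right (by linarith : 0 ≤ t * (B - A - (1 - t) * D)) ht0
  linarith [mul_pos ht0 hε]
end

section
/- Fix σ² > 0, sequences m = (m_c)_{c∈ℕ} and l = (l_c)_{c∈ℕ} of positive reals, and a sequence (aₙ) of positive reals with aₙ → ∞. Then there exists n* ∈ ℕ, depending only on σ², m, l and (aₙ), with the following property: for every n ≥ n*, every choice of metric spaces (𝒳ᵢ,dᵢ), i = 1,…,n, with jointly Borel measurable geodesic CAT(0) structures, every hierarchical model in which θ = (θ₁,…,θₙ) is drawn from a product prior Q⁽ⁿ⁾ = Q₁×⋯×Qₙ ∈ 𝒫_l⁽ⁿ⁾ with Fréchet mean μ⁽ⁿ⁾ and Fréchet variance τ², and, given θ, X = (X₁,…,Xₙ) has conditional product law P_θ = P_{1,θ₁}×⋯×P_{n,θₙ}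 (a Markov kernel in θ) with P_θ ∈ 𝒫_m⁽ⁿ⁾, component Fréchet means θᵢ and Fréchet variance σ² for every θ, and every shrinkage point ψ⁽ⁿ⁾ satisfying d(μ⁽ⁿ⁾,ψ⁽ⁿ⁾)² ≤ n/aₙ, the Bayes risks satisfy E[d(θ,δ_JS(X))²] < E[d(θ,X)²] = σ², where expectations are under the joint law of (θ,X). -/
open MeasureTheory ProbabilityTheory Filter

open scoped ProbabilityTheory

/-- In a (possibly nonseparable) metric space there is a Borel rounding map onto a separated net. -/
theorem exists_measurable_separated_rounding {X : Type*} [MetricSpace X] [MeasurableSpace X]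
    [OpensMeasurableSpace X] {ε : ℝ} (hε : 0 < ε) :
    ∃ r : X → X, Measurable r ∧ (∀ x, dist x (r x) < ε) ∧
      ∀ x y, r x ≠ r y → ε ≤ dist (r x) (r y) := by
  classical
  obtain ⟨S, hS⟩ := zorn_subset {S : Set X | S.Pairwise fun x y => ε ≤ dist x y} (by
    intro c hc hchain
    refine ⟨⋃₀ c, ?_, fun s hs => Set.subset_sUnion_of_mem hs⟩
    exact (Set.pairwise_sUnion hchain.directedOn).2 fun s hs => hc hs)
  have hsep : ∀ p ∈ S, ∀ q ∈ S, p ≠ q → ε ≤ dist p q := fun p hp q hq h => hS.prop hp hq h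
  have hcov : ∀ x : X, {p | p ∈ S ∧ dist x p < ε}.Nonempty := by
    intro x
    by_contra hne
    have hfar : ∀ p ∈ S, ε ≤ dist x p := fun p hp => by
      by_contra hlt
      exact hne ⟨p, hp, not_le.1 hlt⟩
    have hins : insert x S ∈ {S : Set X | S.Pairwise fun x y => ε ≤ dist x y} :=
      Set.Pairwise.insert hS.prop fun p hp _ => ⟨hfar p hp, by rw [dist_comm]; exact hfar p hp⟩
    have hx : x ∈ S := hS.le_of_ge hins (Set.subset_insert x S) (Set.mem_insert x S)
    have := hfar x hx
    rw [dist_self] at this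
    linarith
  have hwf : WellFounded (WellOrderingRel (α := X)) := IsWellFounded.wf
  let r : X → X := fun x => hwf.min {p | p ∈ S ∧ dist x p < ε} (hcov x)
  have hr : ∀ x, r x ∈ S ∧ dist x (r x) < ε := fun x => hwf.min_mem _ (hcov x)
  have hrmin : ∀ x, ∀ q ∈ S, WellOrderingRel q (r x) → ε ≤ dist x q := by
    intro x q hq hlt
    by_contra h
    exact hwf.not_lt_min {p | p ∈ S ∧ dist x p < ε} (x := q) ⟨hq, not_le.1 h⟩ hlt
  refine ⟨r, ?_, fun x => (hr x).2, fun x y h => hsep _ (hr x).1 _ (hr y).1 h⟩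
  intro T _
  let E : ℕ → Set X := fun n => {x | ∃ p ∈ S, p ∈ T ∧ dist x p ≤ ε - 1 / ((n : ℝ) + 1) ∧
    ∀ q ∈ S, WellOrderingRel q p → ε ≤ dist x q}
  have hEclosed : ∀ n, IsClosed (E n) := by
    intro n
    have hn : (0 : ℝ) < 1 / ((n : ℝ) + 1) := by positivity
    refine isClosed_of_closure_subset fun x hx => ?_
    rw [Metric.mem_closure_iff] at hx
    obtain ⟨y, ⟨p, hpS, hpT, hyp, hymin⟩, hxy⟩ := hx (1 / ((n : ℝ) + 1) / 2) (by positivity)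
    have hnear : ∀ δ > 0, ∃ z, dist x z < δ ∧ dist z p ≤ ε - 1 / ((n : ℝ) + 1) ∧
        ∀ q ∈ S, WellOrderingRel q p → ε ≤ dist z q := by
      intro δ hδ
      obtain ⟨z, ⟨p', hpS', hpT', hzp, hzmin⟩, hxz⟩ :=
        hx (min δ (1 / ((n : ℝ) + 1) / 2)) (by positivity)
      have hxz1 := lt_of_lt_of_le hxz (min_le_left _ _)
      have hxz2 := lt_of_lt_of_le hxz (min_le_right _ _)
      have hyz : dist y z < 1 / ((n : ℝ) + 1) := by
        have := dist_triangle_left y z x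
        linarith
      have : p' = p := by
        rcases trichotomous_of WellOrderingRel p' p with h | h | h
        · have h1 := hymin p' hpS' h
          have h2 := dist_triangle y z p'
          linarith
        · exact h
        · have h1 := hzmin p hpS h
          have h2 := dist_triangle_left z p y
          linarith
      subst this
      exact ⟨z, hxz1, hzp, hzmin⟩
    refine ⟨p, hpS, hpT, ?_, fun q hq hqp => ?_⟩
    · refine le_of_forall_pos_le_add fun δ hδ => ?_
      obtain ⟨z, h1, h2, -⟩ := hnear δ hδ
      have := dist_triangle x z p
      linarith
    · refine le_of_forall_pos_le_add fun δ hδ => ?_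
      obtain ⟨z, h1, -, h3⟩ := hnear δ hδ
      have h4 := h3 q hq hqp
      have := dist_triangle_left z q x
      linarith
  have hEq : r ⁻¹' T = ⋃ n, E n := by
    ext x
    simp only [Set.mem_preimage, Set.mem_iUnion]
    constructor
    · intro hx
      obtain ⟨n, hn⟩ := exists_nat_one_div_lt (sub_pos.2 (hr x).2)
      exact ⟨n, r x, (hr x).1, hx, by linarith, hrmin x⟩
    · rintro ⟨n, p, hpS, hpT, hxp, hmin⟩
      have hn : (0 : ℝ) < 1 / ((n : ℝ) + 1) := by positivity
      have : r x = p := by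
        rcases trichotomous_of WellOrderingRel (r x) p with h | h | h
        · have := hmin _ (hr x).1 h
          linarith [(hr x).2]
        · exact h
        · have := hrmin x p hpS h
          linarith
      rwa [this]
  rw [hEq]
  exact MeasurableSet.iUnion fun n => (hEclosed n).measurableSet

/-- Joint measurability of the geodesic map forces joint measurability of the metric, even without
second countability. -/
theorem GeodesicCAT0.MeasurableGeo.measurable_dist {X : Type*} [MetricSpace X]
    [MeasurableSpace X] [OpensMeasurableSpace X] {G : GeodesicCAT0 X} (hG : G.MeasurableGeo) :
    Measurable fun p : X × X => dist p.1 p.2 := by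
  have hround : ∀ r : X → X, Measurable r → ∀ ε > 0,
      (∀ x y, r x ≠ r y → ε ≤ dist (r x) (r y)) →
      Measurable fun p : X × X => dist p.1 (r p.2) := by
    intro r hr ε hε hsep
    let t : ℕ → ℝ := fun k => 1 - 1 / ((k : ℝ) + 1)
    have ht : ∀ k, t k ∈ Set.Icc (0 : ℝ) 1 := fun k => by
      have h0 : (0 : ℝ) < 1 / ((k : ℝ) + 1) := by positivity
      have h1 : 1 / ((k : ℝ) + 1) ≤ 1 := by
        rw [div_le_one (by positivity)]
        linarith [(Nat.cast_nonneg k : (0 : ℝ) ≤ k)]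
      exact ⟨by simp only [t]; linarith, by simp only [t]; linarith⟩
    refine measurable_of_tendsto_metrizable (f := fun (k : ℕ) (p : X × X) =>
      Metric.infDist (G.γ p.1 (r p.2) (t k)) (Set.range r) * ((k : ℝ) + 1)) (fun k => ?_) ?_
    · have h1 : Measurable fun p : X × X => G.γ p.1 (r p.2) (t k) :=
        hG.comp (measurable_fst.prodMk ((hr.comp measurable_snd).prodMk measurable_const))
      exact ((Metric.continuous_infDist_pt (Set.range r)).measurable.comp h1).mul_const _
    · rw [tendsto_pi_nhds]
      rintro ⟨x, y⟩
      have hd : ∀ k, dist (G.γ x (r y) (t k)) (r y) = 1 / ((k : ℝ) + 1) * dist x (r y) := by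
        intro k
        have h := G.dist_γ x (r y) (t k) (ht k) 1 ⟨zero_le_one, le_rfl⟩
        rw [G.γ_one] at h
        have h2 : |t k - 1| = 1 / ((k : ℝ) + 1) := by
          rw [abs_of_nonpos (by linarith [(ht k).2])]
          simp only [t]
          ring
        rw [h, h2]
      have hlim : Tendsto (fun k : ℕ => 1 / ((k : ℝ) + 1) * dist x (r y)) atTop (nhds 0) := by
        simpa using tendsto_one_div_add_atTop_nhds_zero_nat.mul_const (dist x (r y))
      refine tendsto_const_nhds.congr' ?_
      filter_upwards [hlim.eventually (gt_mem_nhds (half_pos hε))] with k hk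
      have hinf : Metric.infDist (G.γ x (r y) (t k)) (Set.range r)
          = dist (G.γ x (r y) (t k)) (r y) := by
        refine le_antisymm (Metric.infDist_le_dist_of_mem ⟨y, rfl⟩) ?_
        refine (Metric.le_infDist ⟨_, Set.mem_range_self y⟩).2 ?_
        rintro _ ⟨z, rfl⟩
        by_cases hz : r z = r y
        · rw [hz]
        · have h1 := hsep z y hz
          have h2 := dist_triangle_left (r z) (r y) (G.γ x (r y) (t k))
          have h3 := hd k
          linarith
      have hk0 : (k : ℝ) + 1 ≠ 0 := by positivity
      simp only [hinf, hd k]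
      field_simp
  have hpos : ∀ k : ℕ, (0 : ℝ) < 1 / ((k : ℝ) + 1) := fun k => by positivity
  choose r hr hnear hsep using fun k : ℕ =>
    exists_measurable_separated_rounding (X := X) (hpos k)
  refine measurable_of_tendsto_metrizable (fun k => hround (r k) (hr k) _ (hpos k) (hsep k)) ?_
  rw [tendsto_pi_nhds]
  rintro ⟨x, y⟩
  have h : Tendsto (fun k => r k y) atTop (nhds y) := by
    rw [tendsto_iff_dist_tendsto_zero]
    refine squeeze_zero (fun _ => dist_nonneg) (fun k => ?_)
      tendsto_one_div_add_atTop_nhds_zero_nat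
    rw [dist_comm]
    exact (hnear k y).le
  exact tendsto_const_nhds.dist h

theorem jsWeight_nonneg {σsq d : ℝ} (hσ : 0 < σsq) (hd : 0 ≤ d) : 0 ≤ jsWeight σsq d := by
  unfold jsWeight
  split_ifs
  · exact zero_le_one
  · positivity

theorem jsWeight_le_one (σsq d : ℝ) : jsWeight σsq d ≤ 1 := by
  unfold jsWeight
  split_ifs
  · exact le_rfl
  · exact min_le_left _ _

theorem jsWeight_mul_le {σsq d : ℝ} (hσ : 0 < σsq) (hd : 0 ≤ d) : jsWeight σsq d * d ≤ σsq := by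
  unfold jsWeight
  split_ifs with h
  · rw [h]
    linarith
  · calc min 1 (σsq / d) * d ≤ σsq / d * d := by gcongr; exact min_le_right _ _
      _ = σsq := div_mul_cancel₀ _ h

theorem jsWeight_of_le {σsq d : ℝ} (hd : 0 ≤ d) (h : d ≤ σsq) : jsWeight σsq d = 1 := by
  unfold jsWeight
  split_ifs with h0
  · rfl
  · exact min_eq_left ((one_le_div (lt_of_le_of_ne hd (Ne.symm h0))).2 h)

theorem jsWeight_of_lt {σsq d : ℝ} (hσ : 0 < σsq) (h : σsq < d) : jsWeight σsq d = σsq / d := by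
  have hd : 0 < d := hσ.trans h
  rw [jsWeight, if_neg hd.ne']
  exact min_eq_right ((div_le_one hd).2 h.le)

theorem abs_jsWeight_sub_le {σsq d e : ℝ} (hσ : 0 < σsq) (hd : 0 ≤ d) (he : σsq ≤ e) :
    |jsWeight σsq d - σsq / e| ≤ |d - e| / e := by
  have he0 : 0 < e := hσ.trans_le he
  rcases le_or_gt d σsq with h | h
  · rw [jsWeight_of_le hd h, abs_of_nonneg (sub_nonneg.2 ((div_le_one he0).2 he)),
      one_sub_div he0.ne', abs_sub_comm]
    gcongr
    exact (sub_le_sub_left h e).trans (le_abs_self _)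
  · have hd0 : 0 < d := hσ.trans h
    have hfac : σsq / d - σsq / e = σsq / d * ((e - d) / e) := by field_simp
    rw [jsWeight_of_lt hσ h, hfac, abs_mul, abs_div (e - d), abs_of_pos he0, abs_sub_comm e d,
      abs_of_pos (div_pos hσ hd0)]
    exact mul_le_of_le_one_left (by positivity) ((div_le_one hd0).2 h.le)

theorem measurable_jsWeight (σsq : ℝ) : Measurable (jsWeight σsq) := by
  unfold jsWeight
  exact Measurable.ite (measurableSet_singleton 0) measurable_const
    (measurable_const.min (measurable_const.div measurable_id))

/-- Lower bound for the expected gain of James–Stein shrinkage, in terms of the variances of the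
squared loss `V` and of the squared distance `D` to the shrinkage point. -/
theorem le_integral_jsWeight_mul {Ω : Type*} [MeasurableSpace Ω] {P : Measure Ω}
    [IsProbabilityMeasure P] {σsq B : ℝ} (hσ : 0 < σsq) (hB : 0 ≤ B) {V D : Ω → ℝ}
    (hV : MemLp V 2 P) (hD : MemLp D 2 P) (hDm : Measurable D) (hD0 : ∀ ω, 0 ≤ D ω)
    (hEV : ∫ ω, V ω ∂P = σsq) (hED : B + σsq ≤ ∫ ω, D ω ∂P) :
    σsq / (∫ ω, D ω ∂P) * (3 / 4 * σsq - (Var[V; P] + 5 / 2 * Var[D; P]) / σsq) ≤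
      ∫ ω, jsWeight σsq (D ω) * (V ω - σsq + D ω - B) ∂P := by
  set E := ∫ ω, D ω ∂P with hE
  have hE0 : 0 < E := by linarith
  have hVi : Integrable V P := hV.integrable one_le_two
  have hDi : Integrable D P := hD.integrable one_le_two
  have hV2 : Integrable (fun ω => (V ω - σsq) ^ 2) P := (hV.sub (memLp_const σsq)).integrable_sq
  have hD2 : Integrable (fun ω => (D ω - E) ^ 2) P := (hD.sub (memLp_const E)).integrable_sq
  have hvV : Var[V; P] = ∫ ω, (V ω - σsq) ^ 2 ∂P := by
    rw [variance_eq_integral hV.aemeasurable, hEV]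
  have hvD : Var[D; P] = ∫ ω, (D ω - E) ^ 2 ∂P := by
    rw [variance_eq_integral hD.aemeasurable]
  have hlow : ∫ ω, σsq / E * (3 / 4 * σsq + ((V ω - σsq) + (D ω - E))
      - ((V ω - σsq) ^ 2 + 5 / 2 * (D ω - E) ^ 2) / σsq) ∂P
      = σsq / E * (3 / 4 * σsq - (Var[V; P] + 5 / 2 * Var[D; P]) / σsq) := by
    rw [integral_const_mul, integral_sub, integral_add, integral_add,
      integral_sub hVi, integral_sub hDi, integral_div, integral_add hV2,
      integral_const_mul, hvV, hvD, hEV]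
    · simp [integral_const_mul, ← hE]
    · exact hD2.const_mul _
    · exact integrable_const _
    · exact integrable_const _
    · exact hVi.sub (integrable_const _)
    · exact hDi.sub (integrable_const _)
    · exact integrable_const _
    · exact (hVi.sub (integrable_const _)).add (hDi.sub (integrable_const _))
    · exact (integrable_const _).add
        ((hVi.sub (integrable_const _)).add (hDi.sub (integrable_const _)))
    · exact (hV2.add (hD2.const_mul _)).div_const _
  rw [← hlow]
  refine integral_mono ?_ ?_ fun ω => ?_
  · exact (((integrable_const _).add
      ((hVi.sub (integrable_const _)).add (hDi.sub (integrable_const _)))).sub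
      ((hV2.add (hD2.const_mul _)).div_const _)).const_mul _
  · refine Integrable.bdd_mul (c := 1)
      (((hVi.sub (integrable_const _)).add hDi).sub (integrable_const _))
      ((measurable_jsWeight σsq).comp hDm).aestronglyMeasurable (ae_of_all _ fun ω => ?_)
    rw [Real.norm_eq_abs, abs_of_nonneg (jsWeight_nonneg hσ (hD0 ω))]
    exact jsWeight_le_one _ _
  · simp only
    have hw := abs_jsWeight_sub_le hσ (hD0 ω) (show σsq ≤ E by linarith)
    have hw0 := jsWeight_nonneg hσ (hD0 ω)
    set w := jsWeight σsq (D ω)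
    set x := V ω - σsq
    set y := D ω - E
    have h1 : w * (x + D ω - B) = w * (E - B) + w * (x + y) := by simp only [y]; ring
    have h2 : w * σsq ≤ w * (E - B) := by gcongr; linarith
    have h3 : -(|y| / E * |x + y|) ≤ (w - σsq / E) * (x + y) := by
      have : |(w - σsq / E) * (x + y)| ≤ |y| / E * |x + y| := by
        rw [abs_mul]
        gcongr
      exact (abs_le.1 this).1
    have h4 : σsq / E - |y| / E ≤ w := by linarith [(abs_le.1 hw).1]
    have h5 : (σsq / E - |y| / E) * σsq ≤ w * σsq := by gcongr
    have h6 : |y| * σsq ≤ σsq ^ 2 / 4 + y ^ 2 := by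
      nlinarith [sq_nonneg (|y| - σsq / 2), sq_abs y]
    have h7 : |y| * |x + y| ≤ x ^ 2 + 3 / 2 * y ^ 2 := by
      nlinarith [sq_nonneg (|y| - |x + y|), sq_abs y, sq_abs (x + y), sq_nonneg (x - y)]
    have h8 : σsq / E * (3 / 4 * σsq + (x + y) - (x ^ 2 + 5 / 2 * y ^ 2) / σsq)
        = (3 / 4 * σsq ^ 2 - (x ^ 2 + 5 / 2 * y ^ 2)) / E + σsq / E * (x + y) := by
      field_simp
      ring
    have h9 : (3 / 4 * σsq ^ 2 - (x ^ 2 + 5 / 2 * y ^ 2)) / E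
        ≤ (σsq / E - |y| / E) * σsq - |y| / E * |x + y| := by
      have : (σsq / E - |y| / E) * σsq - |y| / E * |x + y|
          = (σsq ^ 2 - |y| * σsq - |y| * |x + y|) / E := by
        field_simp
      rw [this]
      exact div_le_div_of_nonneg_right (by linarith) hE0.le
    rw [h8, h1]
    nlinarith [h2, h3, h5, h9]

theorem measurable_dist_right {X : Type*} [MetricSpace X] [MeasurableSpace X]
    [OpensMeasurableSpace X] (z : X) : Measurable fun u : X => dist u z :=
  (continuous_id.dist continuous_const).measurable

theorem dist_sq_le_two_mul {X : Type*} [MetricSpace X] (u v z : X) :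
    dist u z ^ 2 ≤ 2 * dist u v ^ 2 + 2 * dist v z ^ 2 := by
  have h := dist_triangle u v z
  have h0 : 0 ≤ dist u z := dist_nonneg
  nlinarith [sq_nonneg (dist u v - dist v z)]

theorem integrable_dist_sq {X : Type*} [MetricSpace X] [MeasurableSpace X]
    [OpensMeasurableSpace X] {P : Measure X} [IsFiniteMeasure P] {θ : X}
    (h2 : Integrable (fun u => dist u θ ^ 2) P) (z : X) :
    Integrable (fun u => dist u z ^ 2) P := by
  refine Integrable.mono' ((h2.const_mul 2).add (integrable_const (2 * dist θ z ^ 2)))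
    ((measurable_dist_right z).pow_const 2).aestronglyMeasurable (ae_of_all _ fun u => ?_)
  rw [Real.norm_of_nonneg (by positivity)]
  exact dist_sq_le_two_mul u θ z

theorem memLp_two_dist_sq {X : Type*} [MetricSpace X] [MeasurableSpace X]
    [OpensMeasurableSpace X] {P : Measure X} [IsFiniteMeasure P] {θ : X}
    (h4 : Integrable (fun u => dist u θ ^ 4) P) (z : X) :
    MemLp (fun u => dist u z ^ 2) 2 P := by
  have hm := (measurable_dist_right z).pow_const 2
  refine (memLp_two_iff_integrable_sq hm.aestronglyMeasurable).2 ?_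
  refine Integrable.mono' ((h4.const_mul 8).add (integrable_const (8 * dist θ z ^ 4)))
    (hm.pow_const 2).aestronglyMeasurable (ae_of_all _ fun u => ?_)
  rw [Real.norm_of_nonneg (by positivity)]
  have h := dist_sq_le_two_mul u θ z
  have h0 : 0 ≤ dist u z ^ 2 := by positivity
  simp only [Pi.add_apply]
  nlinarith [sq_nonneg (dist u θ ^ 2 - dist θ z ^ 2)]

/-- The variance inequality for Fréchet means in CAT(0) spaces. -/
theorem IsFrechetMean.variance_inequality {X : Type*} [MetricSpace X] [MeasurableSpace X]
    [OpensMeasurableSpace X] (G : GeodesicCAT0 X) {P : Measure X} [IsProbabilityMeasure P] {θ : X}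
    (hθ : IsFrechetMean P θ) (h2 : Integrable (fun u => dist u θ ^ 2) P) (z : X) :
    dist θ z ^ 2 + ∫ u, dist u θ ^ 2 ∂P ≤ ∫ u, dist u z ^ 2 ∂P := by
  have hz := integrable_dist_sq h2 z
  set a := ∫ u, dist u θ ^ 2 ∂P with ha
  set b := ∫ u, dist u z ^ 2 ∂P with hb
  have key : ∀ t ∈ Set.Ioc (0 : ℝ) 1, (1 - t) * dist θ z ^ 2 + a ≤ b := by
    intro t ht
    have h1 : a ≤ ∫ u, dist u (G.γ θ z t) ^ 2 ∂P := by
      simpa only [ha, dist_comm] using hθ (G.γ θ z t)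
    have h3 : ∫ u, dist u (G.γ θ z t) ^ 2 ∂P
        ≤ ∫ u, ((1 - t) * dist u θ ^ 2 + t * dist u z ^ 2 - t * (1 - t) * dist θ z ^ 2) ∂P := by
      refine integral_mono (integrable_dist_sq h2 _)
        (((h2.const_mul _).add (hz.const_mul _)).sub (integrable_const _)) fun u => ?_
      have := G.cat0 θ z u t ⟨ht.1.le, ht.2⟩
      simpa only [dist_comm] using this
    have hsum : Integrable (fun u => (1 - t) * dist u θ ^ 2 + t * dist u z ^ 2) P :=
      (h2.const_mul _).add (hz.const_mul _)
    rw [integral_sub hsum (integrable_const _), integral_add (h2.const_mul _) (hz.const_mul _),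
      integral_const_mul, integral_const_mul,
      ← ha, ← hb] at h3
    simp only [integral_const, probReal_univ, one_smul] at h3
    have h4 : 0 ≤ t * (b - a - (1 - t) * dist θ z ^ 2) := by nlinarith
    have := nonneg_of_mul_nonneg_right h4 ht.1
    linarith
  refine le_of_forall_pos_le_add fun δ hδ => ?_
  have hd : 0 ≤ dist θ z ^ 2 := by positivity
  have ht0 : 0 < min 1 (δ / (dist θ z ^ 2 + 1)) := by positivity
  have h := key _ ⟨ht0, min_le_left _ _⟩
  have h5 : min 1 (δ / (dist θ z ^ 2 + 1)) * (dist θ z ^ 2 + 1) ≤ δ := by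
    rw [← le_div_iff₀ (by positivity)]
    exact min_le_right _ _
  nlinarith

theorem variance_dist_sq_le {X : Type*} [MetricSpace X] [MeasurableSpace X]
    [OpensMeasurableSpace X] {P : Measure X} [IsProbabilityMeasure P] {θ : X}
    (h2 : Integrable (fun u => dist u θ ^ 2) P) (h4 : Integrable (fun u => dist u θ ^ 4) P)
    (z : X) :
    Var[fun u => dist u z ^ 2; P] ≤
      2 * ∫ u, dist u θ ^ 4 ∂P + 8 * dist θ z ^ 2 * ∫ u, dist u θ ^ 2 ∂P := by
  have hm := (measurable_dist_right z).pow_const 2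
  have hmem := memLp_two_dist_sq h4 z
  rw [← variance_sub_const hm.aestronglyMeasurable (dist θ z ^ 2)]
  refine (variance_le_expectation_sq
    (hm.sub_const (dist θ z ^ 2)).aestronglyMeasurable).trans ?_
  rw [← integral_const_mul, ← integral_const_mul, ← integral_add (h4.const_mul _) (h2.const_mul _)]
  refine integral_mono (hmem.sub (memLp_const _)).integrable_sq
    ((h4.const_mul _).add (h2.const_mul _)) fun u => ?_
  simp only [Pi.pow_apply]
  have h1 := abs_le.1 (abs_dist_sub_le u θ z)
  have ha : 0 ≤ dist u θ := dist_nonneg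
  have hb : 0 ≤ dist θ z := dist_nonneg
  have hc : 0 ≤ dist u z := dist_nonneg
  set a := dist u θ
  set b := dist θ z
  set c := dist u z
  have h5 : |c ^ 2 - b ^ 2| ≤ a * (a + 2 * b) := by
    rw [show c ^ 2 - b ^ 2 = (c - b) * (c + b) by ring, abs_mul, abs_of_nonneg (add_nonneg hc hb)]
    have h6 : |c - b| ≤ a := abs_le.2 h1
    have h7 : c + b ≤ a + 2 * b := by linarith
    gcongr
  calc (c ^ 2 - b ^ 2) ^ 2 = |c ^ 2 - b ^ 2| ^ 2 := (sq_abs _).symm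
    _ ≤ (a * (a + 2 * b)) ^ 2 := by gcongr
    _ ≤ 2 * a ^ 4 + 8 * b ^ 2 * a ^ 2 := by nlinarith [sq_nonneg (a * (a - 2 * b))]

section Average

variable {n : ℕ} {X : Fin n → Type*} [∀ i, MeasurableSpace (X i)] {P : ∀ i, Measure (X i)}
  [∀ i, IsProbabilityMeasure (P i)] {f : ∀ i, X i → ℝ}

theorem integrable_average_pi (hf : ∀ i, Integrable (f i) (P i)) :
    Integrable (fun u : ∀ i, X i => (1 / n : ℝ) * ∑ i, f i (u i)) (Measure.pi P) :=
  (integrable_finsetSum _ fun i _ =>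
    (measurePreserving_eval P i).integrable_comp_of_integrable (hf i)).const_mul _

theorem memLp_two_average_pi (hf : ∀ i, MemLp (f i) 2 (P i)) :
    MemLp (fun u : ∀ i, X i => (1 / n : ℝ) * ∑ i, f i (u i)) 2 (Measure.pi P) :=
  (memLp_finsetSum _ fun i _ =>
    (hf i).comp_measurePreserving (measurePreserving_eval P i)).const_mul _

theorem integral_average_pi (hf : ∀ i, Integrable (f i) (P i)) :
    ∫ u : ∀ i, X i, (1 / n : ℝ) * ∑ i, f i (u i) ∂(Measure.pi P)
      = (1 / n : ℝ) * ∑ i, ∫ x, f i x ∂(P i) := by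
  rw [integral_const_mul, integral_finsetSum]
  · congr 1
    exact Finset.sum_congr rfl fun i _ => integral_comp_eval (hf i).aestronglyMeasurable
  · exact fun i _ => (measurePreserving_eval P i).integrable_comp_of_integrable (hf i)

theorem variance_average_pi (hf : ∀ i, MemLp (f i) 2 (P i)) :
    Var[fun u : ∀ i, X i => (1 / n : ℝ) * ∑ i, f i (u i); Measure.pi P]
      = (1 / n : ℝ) ^ 2 * ∑ i, Var[f i; P i] := by
  rw [variance_const_mul, ← variance_sum_pi hf]
  congr 2
  ext u
  simp

end Average

theorem average_le_of_forall_le {n : ℕ} (hn : 0 < n) {f : Fin n → ℝ} {c : ℝ} (h : ∀ i, f i ≤ c) :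
    (1 / n : ℝ) * ∑ i, f i ≤ c := by
  have hn' : (0 : ℝ) < n := Nat.cast_pos.2 hn
  have : ∑ i, f i ≤ n * c := by
    simpa using Finset.sum_le_sum fun i (_ : i ∈ Finset.univ) => h i
  calc (1 / n : ℝ) * ∑ i, f i ≤ 1 / n * (n * c) := by gcongr
    _ = c := by field_simp

/-- The conditional expected gain of the James–Stein estimator given `θ`. -/
theorem le_integral_pi_jsWeight_mul {n : ℕ} (hn : 0 < n) {X : Fin n → Type*}
    [∀ i, MetricSpace (X i)] [∀ i, MeasurableSpace (X i)] [∀ i, OpensMeasurableSpace (X i)]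
    (G : ∀ i, GeodesicCAT0 (X i)) {P : ∀ i, Measure (X i)} [∀ i, IsProbabilityMeasure (P i)]
    {θ : ∀ i, X i} (ψ : ∀ i, X i) {σsq m₂ m₄ : ℝ} (hσ : 0 < σsq) (hm₂ : 0 ≤ m₂) (hm₄ : 0 ≤ m₄)
    (hθ : ∀ i, IsFrechetMean (P i) (θ i))
    (h2 : ∀ i, Integrable (fun u => dist u (θ i) ^ 2) (P i))
    (h4 : ∀ i, Integrable (fun u => dist u (θ i) ^ 4) (P i))
    (hle2 : ∀ i, ∫ u, dist u (θ i) ^ 2 ∂(P i) ≤ m₂)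
    (hle4 : ∀ i, ∫ u, dist u (θ i) ^ 4 ∂(P i) ≤ m₄)
    (hvar : (1 / n : ℝ) * ∑ i, ∫ u, dist u (θ i) ^ 2 ∂(P i) = σsq) :
    3 / 8 * σsq ^ 2 / ((1 / n : ℝ) * ∑ i, dist (θ i) (ψ i) ^ 2 + σsq)
        - (m₄ + 5 / 2 * (2 * m₄ + 8 * m₂)) * (σsq + 1) / σsq / n ≤
      ∫ u : ∀ i, X i, jsWeight σsq ((1 / n : ℝ) * ∑ i, dist (u i) (ψ i) ^ 2) *
        ((1 / n : ℝ) * ∑ i, dist (θ i) (u i) ^ 2 - σsq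
          + (1 / n : ℝ) * ∑ i, dist (u i) (ψ i) ^ 2
          - (1 / n : ℝ) * ∑ i, dist (θ i) (ψ i) ^ 2) ∂(Measure.pi P) := by
  have hn' : (0 : ℝ) < n := Nat.cast_pos.2 hn
  have hsymm : ∀ u : ∀ i, X i, ∑ i, dist (θ i) (u i) ^ 2 = ∑ i, dist (u i) (θ i) ^ 2 :=
    fun u => by simp only [dist_comm]
  set B := (1 / n : ℝ) * ∑ i, dist (θ i) (ψ i) ^ 2 with hBdef
  simp only [hsymm]
  have hB : 0 ≤ B := by positivity
  have hmemV := fun i => memLp_two_dist_sq (h4 i) (θ i)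
  have hmemD := fun i => memLp_two_dist_sq (h4 i) (ψ i)
  have hD := fun i => integrable_dist_sq (h2 i) (ψ i)
  have hEV : ∫ u : ∀ i, X i, (1 / n : ℝ) * ∑ i, dist (u i) (θ i) ^ 2 ∂(Measure.pi P) = σsq := by
    rw [integral_average_pi (f := fun i u => dist u (θ i) ^ 2) h2, hvar]
  have hED := integral_average_pi (f := fun i u => dist u (ψ i) ^ 2) hD
  have hlow : B + σsq ≤ (1 / n : ℝ) * ∑ i, ∫ u, dist u (ψ i) ^ 2 ∂(P i) := by
    rw [hBdef, ← hvar, ← mul_add, ← Finset.sum_add_distrib]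
    gcongr with i
    exact (hθ i).variance_inequality (G i) (h2 i) (ψ i)
  have hupp : (1 / n : ℝ) * ∑ i, ∫ u, dist u (ψ i) ^ 2 ∂(P i) ≤ 2 * (B + σsq) := by
    calc (1 / n : ℝ) * ∑ i, ∫ u, dist u (ψ i) ^ 2 ∂(P i)
        ≤ (1 / n : ℝ) * ∑ i, 2 * (dist (θ i) (ψ i) ^ 2 + ∫ u, dist u (θ i) ^ 2 ∂(P i)) := ?_
      _ = 2 * (B + σsq) := by
          rw [← Finset.mul_sum, Finset.sum_add_distrib, hBdef, ← hvar]
          ring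
    gcongr with i
    calc ∫ u, dist u (ψ i) ^ 2 ∂(P i)
        ≤ ∫ u, (2 * dist u (θ i) ^ 2 + 2 * dist (θ i) (ψ i) ^ 2) ∂(P i) :=
          integral_mono (hD i) (((h2 i).const_mul 2).add (integrable_const _))
            fun u => dist_sq_le_two_mul u (θ i) (ψ i)
      _ = 2 * (dist (θ i) (ψ i) ^ 2 + ∫ u, dist u (θ i) ^ 2 ∂(P i)) := by
          rw [integral_add ((h2 i).const_mul 2) (integrable_const _), integral_const_mul]
          simp
          ring
  have hvD : Var[fun u : ∀ i, X i => (1 / n : ℝ) * ∑ i, dist (u i) (ψ i) ^ 2; Measure.pi P]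
      ≤ (2 * m₄ + 8 * m₂) * (1 + B) / n := by
    rw [variance_average_pi (f := fun i u => dist u (ψ i) ^ 2) hmemD, pow_two, mul_assoc]
    have : (1 / n : ℝ) * ∑ i, Var[fun u => dist u (ψ i) ^ 2; P i] ≤ 2 * m₄ + 8 * m₂ * B := by
      calc (1 / n : ℝ) * ∑ i, Var[fun u => dist u (ψ i) ^ 2; P i]
          ≤ (1 / n : ℝ) * ∑ i, (2 * m₄ + 8 * m₂ * dist (θ i) (ψ i) ^ 2) := by
            gcongr with i
            refine (variance_dist_sq_le (h2 i) (h4 i) (ψ i)).trans ?_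
            have h1 := mul_le_mul_of_nonneg_left (hle2 i)
              (show 0 ≤ 8 * dist (θ i) (ψ i) ^ 2 by positivity)
            linarith [hle4 i]
        _ = 2 * m₄ + 8 * m₂ * B := by
            rw [Finset.sum_add_distrib, ← Finset.mul_sum (f := fun i => dist (θ i) (ψ i) ^ 2),
              hBdef]
            simp
            field_simp
    calc (1 / n : ℝ) * ((1 / n : ℝ) * ∑ i, Var[fun u => dist u (ψ i) ^ 2; P i])
        ≤ 1 / n * (2 * m₄ + 8 * m₂ * B) := by gcongr
      _ ≤ 1 / n * ((2 * m₄ + 8 * m₂) * (1 + B)) := by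
          gcongr
          nlinarith [mul_nonneg hm₄ hB]
      _ = (2 * m₄ + 8 * m₂) * (1 + B) / n := by ring
  have hvV : Var[fun u : ∀ i, X i => (1 / n : ℝ) * ∑ i, dist (u i) (θ i) ^ 2; Measure.pi P]
      ≤ m₄ * (1 + B) / n := by
    rw [variance_average_pi (f := fun i u => dist u (θ i) ^ 2) hmemV, pow_two, mul_assoc]
    have : (1 / n : ℝ) * ∑ i, Var[fun u => dist u (θ i) ^ 2; P i] ≤ m₄ := by
      refine average_le_of_forall_le hn fun i => ?_
      refine (variance_le_expectation_sq
        ((measurable_dist_right (θ i)).pow_const 2).aestronglyMeasurable).trans ?_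
      simpa [← pow_mul] using hle4 i
    calc (1 / n : ℝ) * ((1 / n : ℝ) * ∑ i, Var[fun u => dist u (θ i) ^ 2; P i])
        ≤ 1 / n * m₄ := by gcongr
      _ ≤ 1 / n * (m₄ * (1 + B)) := by
          gcongr
          nlinarith [mul_nonneg hm₄ hB]
      _ = m₄ * (1 + B) / n := by ring
  refine le_trans ?_ (le_integral_jsWeight_mul hσ hB
    (memLp_two_average_pi (f := fun i u => dist u (θ i) ^ 2) hmemV)
    (memLp_two_average_pi (f := fun i u => dist u (ψ i) ^ 2) hmemD) ?_
    (fun u => by positivity) hEV (by rw [hED]; exact hlow))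
  · rw [hED]
    set E := (1 / n : ℝ) * ∑ i, ∫ u, dist u (ψ i) ^ 2 ∂(P i)
    have hE0 : 0 < E := by linarith
    set K := m₄ + 5 / 2 * (2 * m₄ + 8 * m₂) with hK
    have hK0 : 0 ≤ K := by positivity
    have h5 : σsq / E * (1 + B) ≤ σsq + 1 := by
      rw [div_mul_eq_mul_div, div_le_iff₀ hE0]
      nlinarith [mul_le_mul_of_nonneg_left hlow (show 0 ≤ σsq + 1 by linarith)]
    calc 3 / 8 * σsq ^ 2 / (B + σsq) - K * (σsq + 1) / σsq / n
        ≤ σsq / E * (3 / 4 * σsq) - K * (σsq / E * (1 + B)) / σsq / n := by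
          have h6 : 3 / 8 * σsq ^ 2 / (B + σsq) ≤ σsq / E * (3 / 4 * σsq) := by
            rw [div_mul_eq_mul_div σsq, div_le_div_iff₀ (by linarith) hE0]
            nlinarith [mul_le_mul_of_nonneg_left hupp (show 0 ≤ σsq ^ 2 by positivity)]
          have h7 : K * (σsq / E * (1 + B)) / σsq / n ≤ K * (σsq + 1) / σsq / n := by gcongr
          linarith
      _ = σsq / E * (3 / 4 * σsq
            - (m₄ * (1 + B) / n + 5 / 2 * ((2 * m₄ + 8 * m₂) * (1 + B) / n)) / σsq) := by
          rw [hK]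
          ring
      _ ≤ _ := by gcongr
  · exact (Finset.measurable_sum _ fun i _ =>
      ((measurable_dist_right (ψ i)).comp (measurable_pi_apply i)).pow_const 2).const_mul _

/-- The convexity bound comparing the loss of the shrinkage estimator with the loss of `x`. -/
theorem average_dist_sq_geodesic_le {n : ℕ} {X : Fin n → Type*} [∀ i, MetricSpace (X i)]
    (G : ∀ i, GeodesicCAT0 (X i)) {σsq : ℝ} (hσ : 0 < σsq) (θ x ψ : ∀ i, X i) :
    (1 / n : ℝ) * ∑ i, dist (θ i) ((G i).γ (x i) (ψ i)
        (jsWeight σsq ((1 / n : ℝ) * ∑ j, dist (x j) (ψ j) ^ 2))) ^ 2 ≤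
      (1 / n : ℝ) * ∑ i, dist (θ i) (x i) ^ 2
        - jsWeight σsq ((1 / n : ℝ) * ∑ i, dist (x i) (ψ i) ^ 2) *
          ((1 / n : ℝ) * ∑ i, dist (θ i) (x i) ^ 2 - σsq
            + (1 / n : ℝ) * ∑ i, dist (x i) (ψ i) ^ 2
            - (1 / n : ℝ) * ∑ i, dist (θ i) (ψ i) ^ 2) := by
  set D := (1 / n : ℝ) * ∑ i, dist (x i) (ψ i) ^ 2 with hD
  have hD0 : 0 ≤ D := by positivity
  have hw0 := jsWeight_nonneg hσ hD0
  have hw1 := jsWeight_le_one σsq D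
  have hwD := jsWeight_mul_le hσ hD0
  set w := jsWeight σsq D
  calc (1 / n : ℝ) * ∑ i, dist (θ i) ((G i).γ (x i) (ψ i) w) ^ 2
      ≤ (1 / n : ℝ) * ∑ i, ((1 - w) * dist (θ i) (x i) ^ 2 + w * dist (θ i) (ψ i) ^ 2
          - w * (1 - w) * dist (x i) (ψ i) ^ 2) := by
        gcongr with i
        have := (G i).cat0 (x i) (ψ i) (θ i) w ⟨hw0, hw1⟩
        rwa [dist_comm _ (θ i), dist_comm (x i) (θ i), dist_comm (ψ i) (θ i)] at this
    _ = (1 - w) * ((1 / n : ℝ) * ∑ i, dist (θ i) (x i) ^ 2)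
          + w * ((1 / n : ℝ) * ∑ i, dist (θ i) (ψ i) ^ 2) - w * (1 - w) * D := by
        rw [Finset.sum_sub_distrib, Finset.sum_add_distrib, ← Finset.mul_sum, ← Finset.mul_sum,
          ← Finset.mul_sum, hD]
        ring
    _ ≤ _ := by nlinarith [mul_le_mul_of_nonneg_left hwD hw0]

theorem exists_forall_ge_gain_pos {σsq L K : ℝ} (hσ : 0 < σsq) {a : ℕ → ℝ}
    (ha : Tendsto a atTop atTop) :
    ∃ N : ℕ, ∀ n : ℕ, N ≤ n → 0 < n ∧ K * (σsq + L + 2 * (n / a n)) < 3 / 8 * σsq ^ 2 * n := by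
  have h1 : Tendsto (fun n : ℕ => (n : ℝ)⁻¹) atTop (nhds 0) := tendsto_inv_atTop_nhds_zero_nat
  have h2 : Tendsto (fun n : ℕ => K * (σsq + L) * (n : ℝ)⁻¹ + 2 * K * (a n)⁻¹) atTop (nhds 0) := by
    simpa using (h1.const_mul (K * (σsq + L))).add
      ((tendsto_inv_atTop_zero.comp ha).const_mul (2 * K))
  have h3 := h2.eventually_lt_const (show 0 < 3 / 8 * σsq ^ 2 by positivity)
  obtain ⟨N, hN⟩ := eventually_atTop.1 (h3.and (eventually_gt_atTop 0))
  refine ⟨N, fun n hn => ⟨(hN n hn).2, ?_⟩⟩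
  have hn0 : (0 : ℝ) < n := Nat.cast_pos.2 (hN n hn).2
  calc K * (σsq + L + 2 * (n / a n))
      = (K * (σsq + L) * (n : ℝ)⁻¹ + 2 * K * (a n)⁻¹) * n := by
        field_simp
    _ < 3 / 8 * σsq ^ 2 * n := by
        have := (hN n hn).1
        gcongr

theorem two_div_sub_le_inv {y c : ℝ} (hy : 0 < y) (hc : 0 < c) : 2 / c - y / c ^ 2 ≤ 1 / y := by
  rw [div_sub_div _ _ hc.ne' (by positivity), div_le_div_iff₀ (by positivity) hy]
  nlinarith [mul_nonneg hc.le (sq_nonneg (c - y))]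

/-- Bayes-risk domination (Theorem 5).  For fixed `σ² > 0`, moment-bound
sequences `m`, `l`, and `aₙ → ∞`, there is `n*` depending only on `σ², m, l, (aₙ)` such
that for all `n ≥ n*`, all hierarchical CAT(0) models with product prior `Q ∈ 𝒫_l⁽ⁿ⁾`
(Fréchet mean `μ`, Fréchet variance `τ²`) and conditional product law `P_θ ∈ 𝒫_m⁽ⁿ⁾`
(Markov kernel `κ`, component Fréchet means `θᵢ`, Fréchet variance `σ²`), and all
shrinkage points `ψ` with `d(μ,ψ)² ≤ n/aₙ`, the Bayes risks satisfy
`E[d(θ,δ_JS(X))²] < E[d(θ,X)²] = σ²` under the joint law `Q ⊗ₘ κ`. -/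
theorem geodesic_james_stein_bayes_dominates
    (σsq : ℝ) (hσ : 0 < σsq)
    (m l : ℕ → ℝ) (hm : ∀ c, 0 < m c) (hl : ∀ c, 0 < l c)
    (a : ℕ → ℝ) (ha_pos : ∀ n, 0 < a n) (ha : Tendsto a atTop atTop) :
    ∃ nstar : ℕ, ∀ n : ℕ, nstar ≤ n →
      ∀ (X : Fin n → Type*) [∀ i, MetricSpace (X i)]
        [∀ i, MeasurableSpace (X i)] [∀ i, BorelSpace (X i)]
        (G : ∀ i, GeodesicCAT0 (X i)), (∀ i, (G i).MeasurableGeo) →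
      ∀ (Qi : ∀ i, Measure (X i)), (∀ i, IsProbabilityMeasure (Qi i)) →
      ∀ (μ : ∀ i, X i) (τsq : ℝ),
        (∀ i, IsFrechetMean (Qi i) (μ i)) →
        (∀ i, ∀ c, 1 ≤ c → Integrable (fun u => dist u (μ i) ^ c) (Qi i)) →
        (∀ i, ∀ c, 1 ≤ c → 0 < ∫ u, dist u (μ i) ^ c ∂(Qi i)) →
        (∀ i, ∀ c, 1 ≤ c → ∫ u, dist u (μ i) ^ c ∂(Qi i) ≤ l c) →
        ((1 / n : ℝ) * ∑ i, ∫ u, dist u (μ i) ^ 2 ∂(Qi i) = τsq) →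
      ∀ (κ : ProbabilityTheory.Kernel (∀ i, X i) (∀ i, X i)),
        ProbabilityTheory.IsMarkovKernel κ →
        (∀ θ : ∀ i, X i, ∃ Pc : ∀ i, Measure (X i),
          (∀ i, IsProbabilityMeasure (Pc i)) ∧
          κ θ = Measure.pi Pc ∧
          (∀ i, IsFrechetMean (Pc i) (θ i)) ∧
          (∀ i, ∀ c, 1 ≤ c → Integrable (fun u => dist u (θ i) ^ c) (Pc i)) ∧
          (∀ i, ∀ c, 1 ≤ c → 0 < ∫ u, dist u (θ i) ^ c ∂(Pc i)) ∧
          (∀ i, ∀ c, 1 ≤ c → ∫ u, dist u (θ i) ^ c ∂(Pc i) ≤ m c) ∧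
          (1 / n : ℝ) * ∑ i, ∫ u, dist u (θ i) ^ 2 ∂(Pc i) = σsq) →
      ∀ ψ : ∀ i, X i,
        ((1 / n : ℝ) * ∑ i, dist (μ i) (ψ i) ^ 2 ≤ n / a n) →
        (∫ p, ((1 / n : ℝ) * ∑ i, dist (p.1 i)
              ((G i).γ (p.2 i) (ψ i)
                (jsWeight σsq ((1 / n : ℝ) * ∑ j, dist (p.2 j) (ψ j) ^ 2))) ^ 2)
            ∂((Measure.pi Qi) ⊗ₘ κ)
          < ∫ p, ((1 / n : ℝ) * ∑ i, dist (p.1 i) (p.2 i) ^ 2)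
              ∂((Measure.pi Qi) ⊗ₘ κ)) ∧
        ∫ p, ((1 / n : ℝ) * ∑ i, dist (p.1 i) (p.2 i) ^ 2)
            ∂((Measure.pi Qi) ⊗ₘ κ) = σsq := by
  obtain ⟨N, hN⟩ := exists_forall_ge_gain_pos (L := 2 * l 2)
    (K := (m 4 + 5 / 2 * (2 * m 4 + 8 * m 2)) * (σsq + 1) / σsq) hσ ha
  refine ⟨N, fun n hn X _ _ _ G hG Q hQ μ τsq _ hQi _ hQle _ κ hκ hP ψ hψ => ?_⟩
  obtain ⟨hn0, hgain⟩ := hN n hn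
  set K := (m 4 + 5 / 2 * (2 * m 4 + 8 * m 2)) * (σsq + 1) / σsq with hK
  have hn' : (0 : ℝ) < n := Nat.cast_pos.2 hn0
  have han : 0 < (n : ℝ) / a n := div_pos hn' (ha_pos n)
  set c := σsq + 2 * l 2 + 2 * (n / a n) with hc
  have hc0 : 0 < c := by linarith [hl 2]
  let V : (∀ i, X i) × (∀ i, X i) → ℝ := fun p => (1 / n : ℝ) * ∑ i, dist (p.1 i) (p.2 i) ^ 2
  let D : (∀ i, X i) → ℝ := fun x => (1 / n : ℝ) * ∑ i, dist (x i) (ψ i) ^ 2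
  have hV0 : ∀ p, 0 ≤ V p := fun p => by positivity
  have hD0 : ∀ x, 0 ≤ D x := fun x => by positivity
  have hVm : Measurable V := (Finset.measurable_sum _ fun i _ =>
    ((hG i).measurable_dist.comp (((measurable_pi_apply i).comp measurable_fst).prodMk
      ((measurable_pi_apply i).comp measurable_snd))).pow_const 2).const_mul _
  have hDm : Measurable D := (Finset.measurable_sum _ fun i _ =>
    ((measurable_dist_right (ψ i)).comp (measurable_pi_apply i)).pow_const 2).const_mul _
  have hVκ : ∀ θ, Integrable (fun x => V (θ, x)) (κ θ) ∧ ∫ x, V (θ, x) ∂(κ θ) = σsq := by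
    intro θ
    obtain ⟨P, hPp, hκθ, -, hPi, -, -, hvar⟩ := hP θ
    have hPi2 : ∀ i, Integrable (fun u => dist (θ i) u ^ 2) (P i) := fun i => by
      simpa only [dist_comm] using hPi i 2 one_le_two
    rw [hκθ]
    refine ⟨integrable_average_pi (f := fun i u => dist (θ i) u ^ 2) hPi2, ?_⟩
    refine (integral_average_pi (f := fun i u => dist (θ i) u ^ 2) hPi2).trans ?_
    simpa only [dist_comm] using hvar
  have hVi : Integrable V (Measure.pi Q ⊗ₘ κ) := by
    refine (Measure.integrable_compProd_iff hVm.aestronglyMeasurable).2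
      ⟨ae_of_all _ fun θ => (hVκ θ).1, ?_⟩
    simp only [Real.norm_of_nonneg (hV0 _), (hVκ _).2]
    exact integrable_const _
  have hEV : ∫ p, V p ∂(Measure.pi Q ⊗ₘ κ) = σsq := by
    rw [Measure.integral_compProd hVi]
    simp [(hVκ _).2]
  have hQd := fun i => integrable_dist_sq (hQi i 2 one_le_two) (ψ i)
  have hDQ : Integrable D (Measure.pi Q) :=
    integrable_average_pi (f := fun i u => dist u (ψ i) ^ 2) hQd
  have hED : ∫ θ, D θ ∂(Measure.pi Q) ≤ 2 * l 2 + 2 * (n / a n) := by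
    refine (integral_average_pi (f := fun i u => dist u (ψ i) ^ 2) hQd).trans_le ?_
    calc (1 / n : ℝ) * ∑ i, ∫ u, dist u (ψ i) ^ 2 ∂(Q i)
        ≤ (1 / n : ℝ) * ∑ i, (2 * l 2 + 2 * dist (μ i) (ψ i) ^ 2) := ?_
      _ = 2 * l 2 + 2 * ((1 / n : ℝ) * ∑ i, dist (μ i) (ψ i) ^ 2) := by
          rw [Finset.sum_add_distrib, ← Finset.mul_sum (f := fun i => dist (μ i) (ψ i) ^ 2)]
          simp
          field_simp
      _ ≤ 2 * l 2 + 2 * (n / a n) := by gcongr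
    gcongr with i
    calc ∫ u, dist u (ψ i) ^ 2 ∂(Q i)
        ≤ ∫ u, (2 * dist u (μ i) ^ 2 + 2 * dist (μ i) (ψ i) ^ 2) ∂(Q i) :=
          integral_mono (hQd i) (((hQi i 2 one_le_two).const_mul 2).add (integrable_const _))
            fun u => dist_sq_le_two_mul u (μ i) (ψ i)
      _ = 2 * ∫ u, dist u (μ i) ^ 2 ∂(Q i) + 2 * dist (μ i) (ψ i) ^ 2 := by
          rw [integral_add ((hQi i 2 one_le_two).const_mul 2) (integrable_const _),
            integral_const_mul]
          simp
      _ ≤ 2 * l 2 + 2 * dist (μ i) (ψ i) ^ 2 := by linarith [hQle i 2 one_le_two]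
  have hDi : Integrable (fun p : (∀ i, X i) × (∀ i, X i) => D p.1) (Measure.pi Q ⊗ₘ κ) := by
    refine (Measure.integrable_compProd_iff
      (hDm.comp measurable_fst).aestronglyMeasurable).2 ⟨ae_of_all _ fun θ => ?_, ?_⟩
    · exact integrable_const (μ := κ θ) (D θ)
    · simpa [abs_of_nonneg (hD0 _)] using hDQ
  let g : (∀ i, X i) × (∀ i, X i) → ℝ := fun p =>
    jsWeight σsq (D p.2) * (V p - σsq + D p.2 - D p.1)
  have hgm : Measurable g := ((measurable_jsWeight σsq).comp (hDm.comp measurable_snd)).mul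
    (((hVm.sub_const σsq).add (hDm.comp measurable_snd)).sub (hDm.comp measurable_fst))
  have hgi : Integrable g (Measure.pi Q ⊗ₘ κ) := by
    refine ((hVi.add (integrable_const (2 * σsq))).add hDi).mono' hgm.aestronglyMeasurable
      (ae_of_all _ fun p => ?_)
    have hw0 := jsWeight_nonneg hσ (hD0 p.2)
    have hw1 := jsWeight_le_one σsq (D p.2)
    have hwD := jsWeight_mul_le hσ (hD0 p.2)
    have hwD0 := mul_nonneg hw0 (hD0 p.2)
    have hwV := mul_le_mul_of_nonneg_right hw1 (hV0 p)
    have hwV0 := mul_nonneg hw0 (hV0 p)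
    have hwB := mul_le_mul_of_nonneg_right hw1 (hD0 p.1)
    have hwB0 := mul_nonneg hw0 (hD0 p.1)
    have hwσ := mul_le_mul_of_nonneg_right hw1 hσ.le
    have hwσ0 := mul_nonneg hw0 hσ.le
    rw [Real.norm_eq_abs, abs_le]
    simp only [g, Pi.add_apply]
    constructor <;> linarith
  have hgκ : ∀ θ, 3 / 8 * σsq ^ 2 * (2 / c - (D θ + σsq) / c ^ 2) - K / n
      ≤ ∫ x, g (θ, x) ∂(κ θ) := by
    intro θ
    obtain ⟨P, hPp, hκθ, hPf, hPi, -, hPle, hvar⟩ := hP θ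
    have h1 := le_integral_pi_jsWeight_mul hn0 G ψ hσ (hm 2).le (hm 4).le hPf
      (fun i => hPi i 2 (by norm_num)) (fun i => hPi i 4 (by norm_num))
      (fun i => hPle i 2 (by norm_num)) (fun i => hPle i 4 (by norm_num)) hvar
    rw [hκθ]
    refine le_trans ?_ h1
    have h2 := two_div_sub_le_inv (show 0 < D θ + σsq by linarith [hD0 θ]) hc0
    calc 3 / 8 * σsq ^ 2 * (2 / c - (D θ + σsq) / c ^ 2) - K / n
        ≤ 3 / 8 * σsq ^ 2 * (1 / (D θ + σsq)) - K / n := by gcongr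
      _ = 3 / 8 * σsq ^ 2 / (D θ + σsq) - K / n := by rw [mul_one_div]
  have hgκi : Integrable (fun θ => ∫ x, g (θ, x) ∂(κ θ)) (Measure.pi Q) := by
    simpa using (show Integrable g
      ((Kernel.const Unit (Measure.pi Q) ⊗ₖ Kernel.prodMkLeft Unit κ) ()) from
        hgi).integral_compProd
  have hgpos : 0 < ∫ p, g p ∂(Measure.pi Q ⊗ₘ κ) := by
    have hD' : Integrable (fun θ => (D θ + σsq) / c ^ 2) (Measure.pi Q) :=
      (hDQ.add (integrable_const _)).div_const _
    have haff : Integrable (fun θ => 3 / 8 * σsq ^ 2 * (2 / c - (D θ + σsq) / c ^ 2))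
        (Measure.pi Q) := ((integrable_const _).sub hD').const_mul _
    calc 0 < 3 / 8 * σsq ^ 2 / c - K / n := by
          rw [sub_pos, div_lt_div_iff₀ hn' hc0]
          exact hgain
      _ = 3 / 8 * σsq ^ 2 * (2 / c - c / c ^ 2) - K / n := by
          field_simp
          ring
      _ ≤ 3 / 8 * σsq ^ 2 * (2 / c - (∫ θ, D θ ∂(Measure.pi Q) + σsq) / c ^ 2) - K / n := by
          gcongr
          linarith
      _ = ∫ θ, (3 / 8 * σsq ^ 2 * (2 / c - (D θ + σsq) / c ^ 2) - K / n) ∂(Measure.pi Q) := by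
          rw [integral_sub haff (integrable_const _), integral_const_mul (3 / 8 * σsq ^ 2),
            integral_sub (integrable_const _) hD', integral_div (c ^ 2),
            integral_add hDQ (integrable_const _)]
          simp
      _ ≤ ∫ θ, ∫ x, g (θ, x) ∂(κ θ) ∂(Measure.pi Q) :=
          integral_mono (haff.sub (integrable_const _)) hgκi hgκ
      _ = ∫ p, g p ∂(Measure.pi Q ⊗ₘ κ) := (Measure.integral_compProd hgi).symm
  refine ⟨?_, hEV⟩
  calc ∫ p, ((1 / n : ℝ) * ∑ i, dist (p.1 i) ((G i).γ (p.2 i) (ψ i)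
          (jsWeight σsq ((1 / n : ℝ) * ∑ j, dist (p.2 j) (ψ j) ^ 2))) ^ 2)
        ∂(Measure.pi Q ⊗ₘ κ)
      ≤ ∫ p, (V p - g p) ∂(Measure.pi Q ⊗ₘ κ) :=
        integral_mono_of_nonneg (ae_of_all _ fun p => by positivity) (hVi.sub hgi)
          (ae_of_all _ fun p => average_dist_sq_geodesic_le G hσ p.1 p.2 ψ)
    _ = ∫ p, V p ∂(Measure.pi Q ⊗ₘ κ) - ∫ p, g p ∂(Measure.pi Q ⊗ₘ κ) := integral_sub hVi hgi
    _ < ∫ p, V p ∂(Measure.pi Q ⊗ₘ κ) := sub_lt_self _ hgpos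
end
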